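/- Let A be a symmetric unimodular integral 22×22 matrix with inverse B = (b_ij). Consider the (276)×(276) integer matrix M representing the map Sym²(ℤ^{23}) → ℤ^{276} described as follows with respect to suitable bases: it has 22 diagonal entries equal to 2, then 231 diagonal entries equal to 1, then one diagonal entry equal to −1 whose row contains the entries −b_ij and whose column contains the entries a_ij as specified, followed by 22 diagonal entries equal to 2, all other entries zero. Then det(M) = ±5 · 2^{45}. -/

import Mathlib

open Matrix

/-- Index type for the middle "231" block: pairs `i < j` in `Fin 22`. -/
abbrev PairIdx : Type := {p : Fin 22 × Fin 22 // p.1 < p.2}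

/-- Index type for the 276 × 276 matrix: 22 + 231 + 1 + 22 entries. -/
abbrev BigIdx : Type := (Fin 22 ⊕ PairIdx) ⊕ (Unit ⊕ Fin 22)

/-- The matrix `M_ρ̃` of the paper: block diagonal `(2·I₂₂, I₂₃₁, −1, 2·I₂₂)`, where the row
through the `−1` entry carries the entries `−B i i` (first block) and `−B i j` (middle block),
and the column through the `−1` entry carries `A i i` and `A i j`. -/
def bigM (A B : Matrix (Fin 22) (Fin 22) ℤ) : Matrix BigIdx BigIdx ℤ :=
  fun r c =>
    match r, c with
    | .inl (.inl i), .inl (.inl j) => if i = j then 2 else 0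
    | .inl (.inr p), .inl (.inr q) => if p = q then 1 else 0
    | .inl (.inl i), .inr (.inl _) => A i i
    | .inl (.inr p), .inr (.inl _) => A p.1.1 p.1.2
    | .inr (.inl _), .inl (.inl i) => -(B i i)
    | .inr (.inl _), .inl (.inr p) => -(B p.1.1 p.1.2)
    | .inr (.inl _), .inr (.inl _) => -1
    | .inr (.inr i), .inr (.inr j) => if i = j then 2 else 0
    | _, _ => 0

/-- Split a symmetric double sum into the diagonal and twice the strict upper part. -/
lemma sum_split (f : Fin 22 → Fin 22 → ℤ) (hf : ∀ i j, f i j = f j i) :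
    ∑ i, ∑ j, f i j = ∑ i, f i i + 2 * ∑ p : PairIdx, f p.1.1 p.1.2 := by
  have h1 : ∑ p : PairIdx, f p.1.1 p.1.2 = ∑ i, ∑ j, if i < j then f i j else 0 := by
    rw [← Fintype.sum_prod_type' (f := fun i j => if i < j then f i j else 0),
      ← Finset.sum_filter]
    exact (Finset.sum_subtype (Finset.univ.filter fun p : Fin 22 × Fin 22 => p.1 < p.2)
      (by simp) (fun p : Fin 22 × Fin 22 => f p.1 p.2)).symm
  have h2 : ∑ i, ∑ j, (if i < j then f i j else 0) = ∑ i, ∑ j, if j < i then f i j else 0 := by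
    rw [Finset.sum_comm]
    refine Finset.sum_congr rfl fun i _ => Finset.sum_congr rfl fun j _ => ?_
    rw [hf]
  have h3 : ∑ i, f i i = ∑ i, ∑ j, if i = j then f i j else 0 := by simp
  rw [two_mul, h1]
  nth_rewrite 2 [h2]
  rw [h3, ← Finset.sum_add_distrib, ← Finset.sum_add_distrib]
  refine Finset.sum_congr rfl fun i _ => ?_
  rw [← Finset.sum_add_distrib, ← Finset.sum_add_distrib]
  refine Finset.sum_congr rfl fun j _ => ?_
  rcases lt_trichotomy i j with h | h | h
  · simp [h, h.ne, h.not_gt]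
  · simp [h]
  · simp [h, h.ne', h.not_gt]

lemma key_sum (A B : Matrix (Fin 22) (Fin 22) ℤ)
    (hsymm : A.transpose = A) (hAB : A * B = 1) :
    ∑ i, B i i * A i i + 2 * ∑ p : PairIdx, B p.1.1 p.1.2 * A p.1.1 p.1.2 = 22 := by
  have h1 : B.transpose * A = 1 := by
    have := congrArg Matrix.transpose hAB
    rwa [Matrix.transpose_mul, hsymm, Matrix.transpose_one] at this
  have hB : B.transpose = B := by
    calc B.transpose = B.transpose * (A * B) := by rw [hAB, mul_one]
      _ = B := by rw [← mul_assoc, h1, one_mul]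
  have hA' : ∀ i j, A i j = A j i := fun i j => congrFun (congrFun hsymm j) i
  have hB' : ∀ i j, B i j = B j i := fun i j => congrFun (congrFun hB j) i
  rw [← sum_split (fun i j => B i j * A i j) (fun i j => by simp only [hA' i j, hB' i j])]
  have ht : (A * B).trace = 22 := by rw [hAB]; simp
  rw [← ht]
  simp only [Matrix.trace, Matrix.diag, Matrix.mul_apply]
  refine Finset.sum_congr rfl fun i _ => Finset.sum_congr rfl fun j _ => ?_
  rw [hB' i j, mul_comm]

def auxD : Fin 22 ⊕ PairIdx → ℤ := Sum.elim (fun _ => 2) (fun _ => 1)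

def auxV (A : Matrix (Fin 22) (Fin 22) ℤ) : Matrix (Fin 22 ⊕ PairIdx) (Unit ⊕ Fin 22) ℤ :=
  fun r c => Sum.elim (fun _ => Sum.elim (fun i => A i i) (fun p => A p.1.1 p.1.2) r) (fun _ => 0) c

def auxU (A : Matrix (Fin 22) (Fin 22) ℤ) : Matrix (Fin 22 ⊕ PairIdx) (Unit ⊕ Fin 22) ℤ :=
  fun r c => Sum.elim
    (fun _ => Sum.elim (fun i => -A i i) (fun p => -(2 * A p.1.1 p.1.2)) r) (fun _ => 0) c

def auxW (B : Matrix (Fin 22) (Fin 22) ℤ) : Matrix (Unit ⊕ Fin 22) (Fin 22 ⊕ PairIdx) ℤ :=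
  fun r c => Sum.elim
    (fun _ => Sum.elim (fun i => -B i i) (fun p => -B p.1.1 p.1.2) c) (fun _ => 0) r

lemma bigM_eq (A B : Matrix (Fin 22) (Fin 22) ℤ) :
    bigM A B = Matrix.fromBlocks (Matrix.diagonal auxD) (auxV A) (auxW B)
      (Matrix.diagonal (Sum.elim (fun _ => -1) (fun _ => 2))) := by
  ext r c
  rcases r with (i | p) | (u | i) <;> rcases c with (j | q) | (v | j) <;>
    simp [bigM, auxD, auxV, auxW, Matrix.diagonal_apply]

lemma prod_auxD : ∏ x, auxD x = 2 ^ 22 := by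
  simp [auxD]

/-- for a symmetric unimodular integral 22 × 22 matrix `A` with integral inverse
`B`, the determinant of the 276 × 276 matrix `M_ρ̃` described above is `±5·2⁴⁵`. -/
theorem stmt4 (A B : Matrix (Fin 22) (Fin 22) ℤ)
    (hsymm : A.transpose = A) (hAB : A * B = 1) (hBA : B * A = 1) :
    (bigM A B).det = 5 * 2 ^ 45 ∨ (bigM A B).det = -(5 * 2 ^ 45) := by
  left
  have hk := key_sum A B hsymm hAB
  have hmul : bigM A B * Matrix.fromBlocks 1 (auxU A) 0
      (Matrix.diagonal (Sum.elim (fun _ => 2) (fun _ => 1))) =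
      Matrix.fromBlocks (Matrix.diagonal auxD) 0 (auxW B)
        (Matrix.diagonal (Sum.elim (fun _ => 20) (fun _ => 2))) := by
    rw [bigM_eq, Matrix.fromBlocks_multiply]
    congr 1
    · simp
    · ext r c
      rcases r with i | p <;> rcases c with v | j <;> simp [auxD, auxU, auxV] <;> ring
    · simp
    · ext r c
      rcases r with u | i <;> rcases c with v | j
      · simp [Matrix.mul_apply, auxW, auxU]
        have : ∑ p : PairIdx, B p.1.1 p.1.2 * (2 * A p.1.1 p.1.2)
            = 2 * ∑ p : PairIdx, B p.1.1 p.1.2 * A p.1.1 p.1.2 := by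
          rw [Finset.mul_sum]
          exact Finset.sum_congr rfl fun p _ => by ring
        linarith
      · simp [Matrix.mul_apply, auxU]
      · simp [Matrix.mul_apply, auxW]
      · simp [Matrix.mul_apply, auxW, Matrix.diagonal_apply]
  have hd := congrArg Matrix.det hmul
  rw [Matrix.det_mul, Matrix.det_fromBlocks_zero₂₁, Matrix.det_fromBlocks_zero₁₂,
    Matrix.det_diagonal, Matrix.det_diagonal, Matrix.det_diagonal, prod_auxD] at hd
  simp at hd
  linarith
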